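/- Let S be a positive Markov martingale with kernel K such that for some (equivalently every) x_a > 0, inf_{x∈[x_a,y]} K(x,[0,x)) > 0 for all y > x_a. Then the default function M_S equals 𝒦^∞(id), the pointwise limit of the iterates of 𝒦 applied to the identity function, and it is the maximal solution in I of M(x) = ∫_{[x,∞)} M(y)K(x,dy). Moreover M_S(x) < x for all x > 0, and if M_S ≢ 0 then limsup_{x→∞} M_S(x)/x = 1. -/

import Mathlib

open MeasureTheory Filter Set

noncomputable section

variable {Ω : Type*}

/-- Evaluation of a discrete-time process at a possibly infinite random time `τ`,
using the limit variable `Sinf` on the event `{τ = ∞}`. -/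
def evalAt (S : ℕ → Ω → ℝ) (Sinf : Ω → ℝ) (τ : Ω → ℕ∞) (ω : Ω) : ℝ :=
  if τ ω = ⊤ then Sinf ω else S (τ ω).toNat ω

/-- The `k`-th drawdown time of `S`: `τ₀ = 0` and
`τ_k = inf {j > τ_{k-1} : S_j < S_{j-1}}` (with value `∞` if no such `j` exists). -/
def drawdown (S : ℕ → Ω → ℝ) : ℕ → Ω → ℕ∞
  | 0 => fun _ => 0
  | (k + 1) => fun ω =>
      sInf {j : ℕ∞ | drawdown S k ω < j ∧ ∃ n : ℕ, j = (n : ℕ∞) ∧ S n ω < S (n - 1) ω}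

/-- The first drawdown of `S` after the deterministic time `k`:
`τ̃_k = inf {j > k : S_j < S_{j-1}}`. -/
def drawdownAfter (S : ℕ → Ω → ℝ) (k : ℕ) (ω : Ω) : ℕ∞ :=
  sInf {j : ℕ∞ | (k : ℕ∞) < j ∧ ∃ n : ℕ, j = (n : ℕ∞) ∧ S n ω < S (n - 1) ω}

/-- The process stopped at a possibly infinite random time. -/
def stoppedAt (S : ℕ → Ω → ℝ) (τ : Ω → ℕ∞) (n : ℕ) (ω : Ω) : ℝ :=
  S ((min (n : ℕ∞) (τ ω)).toNat) ω

/-- The event `{S_k ≤ S_{k+1} ≤ ⋯ ≤ S_n}`. -/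
def monoEvent (S : ℕ → Ω → ℝ) (k n : ℕ) : Set Ω :=
  {ω | ∀ j, k ≤ j → j < n → S j ω ≤ S (j + 1) ω}

/-- `S` is a bubble under `P`: it loses mass at its `k`-th drawdown time for some `k ≥ 1`. -/
def IsBubble [MeasurableSpace Ω] (S : ℕ → Ω → ℝ) (Sinf : Ω → ℝ) (P : Measure Ω) : Prop :=
  ∃ k : ℕ, ∫ ω, evalAt S Sinf (drawdown S (k + 1)) ω ∂P < ∫ ω, S 0 ω ∂P

end

noncomputable section

open ProbabilityTheory

/-- A positive time-homogeneous Markov martingale on `(0, ∞)` with transition kernel `K`,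
together with its family of laws `P x` (start at `x`) and the a.s. limit `Sinf`. -/
structure MarkovMartingale (Ω : Type*) [m0 : MeasurableSpace Ω] where
  P : ℝ → Measure Ω
  F : Filtration ℕ m0
  S : ℕ → Ω → ℝ
  Sinf : Ω → ℝ
  K : Kernel ℝ ℝ
  markov : IsMarkovKernel K
  prob : ∀ x, 0 < x → IsProbabilityMeasure (P x)
  pos : ∀ x, 0 < x → ∀ᵐ ω ∂P x, ∀ n, 0 < S n ω
  start : ∀ x, 0 < x → ∀ᵐ ω ∂P x, S 0 ω = x
  mart : ∀ x, 0 < x → Martingale S F (P x)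
  conv : ∀ x, 0 < x → ∀ᵐ ω ∂P x, Tendsto (fun n => S n ω) atTop (nhds (Sinf ω))
  kernel_pos : ∀ x, 0 < x → K x (Set.Iic 0) = 0
  kernel_int : ∀ x, 0 < x → Integrable id (K x)
  kernel_mart : ∀ x, 0 < x → ∫ y, y ∂(K x) = x
  step : ∀ x, 0 < x → ∀ n : ℕ, ∀ g : ℝ → ℝ, Measurable g → (∃ C, ∀ y, |g y| ≤ C) →
    (P x)[fun ω => g (S (n + 1) ω) | F n] =ᵐ[P x] fun ω => ∫ y, g y ∂(K (S n ω))

namespace MarkovMartingale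

variable {Ω : Type*} [MeasurableSpace Ω]

/-- The probability `a(x) = K(x, [0,x))` of a downward move from `x`. -/
def a (M : MarkovMartingale Ω) (x : ℝ) : ℝ := (M.K x (Set.Ico 0 x)).toReal

/-- The relative recovery `b(x) = (1/x) ∫_{[0,x)} y K(x,dy)` upon a downward move. -/
def b (M : MarkovMartingale Ω) (x : ℝ) : ℝ := (1 / x) * ∫ y in Set.Ico 0 x, y ∂(M.K x)

/-- The relaxed relative recovery `b_ε(x) = (1/x) ∫_{[0,x(1+ε))} y K(x,dy)`. -/
def bEps (M : MarkovMartingale Ω) (ε x : ℝ) : ℝ :=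
  (1 / x) * ∫ y in Set.Ico 0 (x * (1 + ε)), y ∂(M.K x)

/-- `S` is a bubble under `P_x`. -/
def Bubble (M : MarkovMartingale Ω) (x : ℝ) : Prop := IsBubble M.S M.Sinf (M.P x)

/-- `S` is `P_x`-a.s. bounded. -/
def Bounded (M : MarkovMartingale Ω) (x : ℝ) : Prop :=
  ∃ C : ℝ, ∀ᵐ ω ∂M.P x, ∀ n, M.S n ω ≤ C

/-- The default function `M_S(x) = x - E_x[S_{τ₁}]`, the loss of mass at the first
drawdown. -/
def defaultFn (M : MarkovMartingale Ω) (x : ℝ) : ℝ :=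
  x - ∫ ω, evalAt M.S M.Sinf (drawdown M.S 1) ω ∂(M.P x)

/-- The assumption that the downward-move probability `a` is locally bounded away from zero
above a level `xa`. -/
def ALowerBound (M : MarkovMartingale Ω) (xa : ℝ) : Prop :=
  0 < xa ∧ ∀ y, xa < y → ∃ c > (0 : ℝ), ∀ x ∈ Set.Icc xa y, c ≤ M.a x

end MarkovMartingale

end

noncomputable section

open ProbabilityTheory

/-- Membership in the class `I` of Borel functions `M : (0,∞) → [0,∞)` with `M(x) ≤ x`. -/
def InDom (M : ℝ → ℝ) : Prop := Measurable M ∧ ∀ x : ℝ, 0 < x → 0 ≤ M x ∧ M x ≤ x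

/-- The Volterra operator `𝒦(M)(x) = ∫_{[x,∞)} M(y) K(x,dy)`. -/
def volOp (K : Kernel ℝ ℝ) (M : ℝ → ℝ) : ℝ → ℝ :=
  fun x => ∫ y in Set.Ici x, M y ∂(K x)

open scoped ENNReal

/-- The Volterra operator `𝒦` acting on `[0, ∞]`-valued functions. -/
def lvolOp (K : Kernel ℝ ℝ) (f : ℝ → ℝ≥0∞) : ℝ → ℝ≥0∞ :=
  fun x => ∫⁻ y in Set.Ici x, f y ∂(K x)

lemma measurable_lvolOp (K : Kernel ℝ ℝ) [IsMarkovKernel K] {f : ℝ → ℝ≥0∞}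
    (hf : Measurable f) : Measurable (lvolOp K f) := by
  have hs : MeasurableSet {p : ℝ × ℝ | p.1 ≤ p.2} :=
    measurableSet_le measurable_fst measurable_snd
  have h : lvolOp K f = fun x =>
      ∫⁻ y, {p : ℝ × ℝ | p.1 ≤ p.2}.indicator (fun p => f p.2) (x, y) ∂(K x) := by
    funext x
    rw [lvolOp, ← lintegral_indicator measurableSet_Ici]
    rfl
  rw [h]
  exact ((hf.comp measurable_snd).indicator hs).lintegral_kernel_prod_right'

lemma measurable_lvolOp_iterate (K : Kernel ℝ ℝ) [IsMarkovKernel K] {f : ℝ → ℝ≥0∞}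
    (hf : Measurable f) (n : ℕ) : Measurable ((lvolOp K)^[n] f) := by
  induction n with
  | zero => exact hf
  | succ n ih =>
    rw [Function.iterate_succ_apply']
    exact measurable_lvolOp K ih

lemma lvolOp_mono (K : Kernel ℝ ℝ) {f g : ℝ → ℝ≥0∞} {x : ℝ}
    (h : ∀ y, x ≤ y → f y ≤ g y) : lvolOp K f x ≤ lvolOp K g x :=
  setLIntegral_mono' measurableSet_Ici fun y hy => h y hy

lemma lvolOp_congr (K : Kernel ℝ ℝ) {f g : ℝ → ℝ≥0∞} {x : ℝ}
    (h : ∀ y, x ≤ y → f y = g y) : lvolOp K f x = lvolOp K g x :=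
  setLIntegral_congr_fun measurableSet_Ici fun y hy => h y hy

lemma lvolOp_const_mul (K : Kernel ℝ ℝ) {f : ℝ → ℝ≥0∞} (hf : Measurable f) (c : ℝ≥0∞) (x : ℝ) :
    lvolOp K (fun y => c * f y) x = c * lvolOp K f x :=
  lintegral_const_mul c hf

/-- If `f` is a fixed point of `𝒦` above `x₀` and `f ≤ c • g` there, then `f ≤ c • 𝒦ⁿ g` there. -/
lemma le_const_mul_iterate (K : Kernel ℝ ℝ) [IsMarkovKernel K] {f g : ℝ → ℝ≥0∞}
    (hg : Measurable g) {c : ℝ≥0∞} {x₀ : ℝ} (hfix : ∀ x, x₀ ≤ x → f x = lvolOp K f x)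
    (h : ∀ x, x₀ ≤ x → f x ≤ c * g x) (n : ℕ) :
    ∀ x, x₀ ≤ x → f x ≤ c * (lvolOp K)^[n] g x := by
  induction n with
  | zero => exact h
  | succ n ih =>
    intro x hx
    rw [Function.iterate_succ_apply', hfix x hx,
      ← lvolOp_const_mul K (measurable_lvolOp_iterate K hg n)]
    exact lvolOp_mono K fun y hy => ih y (hx.trans hy)

/-- The iterates `𝒦ⁿ(id)` as `[0, ∞]`-valued functions. -/
def lvolIter (K : Kernel ℝ ℝ) (n : ℕ) : ℝ → ℝ≥0∞ := (lvolOp K)^[n] ENNReal.ofReal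

/-- The limit `𝒦^∞(id)` as an `[0, ∞]`-valued function. -/
def lvolLim (K : Kernel ℝ ℝ) (x : ℝ) : ℝ≥0∞ := ⨅ n, lvolIter K n x

lemma measurable_lvolIter (K : Kernel ℝ ℝ) [IsMarkovKernel K] (n : ℕ) :
    Measurable (lvolIter K n) :=
  measurable_lvolOp_iterate K ENNReal.measurable_ofReal n

lemma measurable_lvolLim (K : Kernel ℝ ℝ) [IsMarkovKernel K] : Measurable (lvolLim K) :=
  Measurable.iInf (measurable_lvolIter K)

lemma lvolIter_succ (K : Kernel ℝ ℝ) (n : ℕ) :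
    lvolIter K (n + 1) = lvolOp K (lvolIter K n) :=
  Function.iterate_succ_apply' _ _ _

lemma measurableSet_monoEvent {m : MeasurableSpace Ω} {S : ℕ → Ω → ℝ} {n : ℕ}
    (hS : ∀ j, j ≤ n → Measurable[m] (S j)) : MeasurableSet[m] (monoEvent S 0 n) := by
  have : monoEvent S 0 n = ⋂ j, ⋂ (_ : j < n), {ω | S j ω ≤ S (j + 1) ω} := by
    ext ω
    simp [monoEvent]
  rw [this]
  exact MeasurableSet.iInter fun j => MeasurableSet.iInter fun hj =>
    measurableSet_le (hS j hj.le) (hS (j + 1) hj)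

lemma monoEvent_zero (S : ℕ → Ω → ℝ) : monoEvent S 0 0 = univ := by
  ext ω
  simp [monoEvent]

lemma monoEvent_succ (S : ℕ → Ω → ℝ) (n : ℕ) :
    monoEvent S 0 (n + 1) = monoEvent S 0 n ∩ {ω | S n ω ≤ S (n + 1) ω} := by
  ext ω
  simp only [monoEvent, mem_ofPred_eq, mem_inter_iff]
  refine ⟨fun h => ⟨fun j h0 hj => h j h0 (by omega), h n (by omega) (by omega)⟩, ?_⟩
  rintro ⟨h, hn⟩ j h0 hj
  rcases Nat.lt_succ_iff_lt_or_eq.mp hj with hj | rfl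
  · exact h j h0 hj
  · exact hn

/-- If the path first moves down at step `n + 1`, the first drawdown value is `S_{n+1}`. -/
lemma evalAt_drawdown_one {S : ℕ → Ω → ℝ} (Sinf : Ω → ℝ) {n : ℕ} {ω : Ω}
    (h : ω ∈ monoEvent S 0 n \ monoEvent S 0 (n + 1)) :
    evalAt S Sinf (drawdown S 1) ω = S (n + 1) ω := by
  have hn : ω ∈ monoEvent S 0 n := h.1
  have hlt : S (n + 1) ω < S n ω := by
    by_contra! hle
    exact h.2 (monoEvent_succ S n ▸ ⟨hn, hle⟩)
  have hτ : drawdown S 1 ω = ((n + 1 : ℕ) : ℕ∞) := by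
    apply le_antisymm
    · exact sInf_le ⟨by simp [drawdown], n + 1, rfl, by simpa using hlt⟩
    · apply le_sInf
      rintro j ⟨hj0, k, rfl, hk⟩
      have hk0 : 0 < k := by simpa [drawdown] using hj0
      by_contra! hkn
      have hkn' : k < n + 1 := by exact_mod_cast hkn
      have := hn (k - 1) (Nat.zero_le _) (by omega)
      rw [Nat.sub_add_cancel hk0] at this
      exact absurd hk (not_lt.mpr this)
  rw [evalAt, hτ, if_neg (ENat.natCast_ne_top _), ENat.toNat_natCast]

lemma iUnion_monoEvent_diff (S : ℕ → Ω → ℝ) :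
    ⋃ n, monoEvent S 0 n \ monoEvent S 0 (n + 1) = (⋂ n, monoEvent S 0 n)ᶜ := by
  ext ω
  simp only [mem_iUnion, mem_compl_iff, mem_iInter]
  refine ⟨fun ⟨n, hn⟩ h => hn.2 (h (n + 1)), fun h => ?_⟩
  by_contra! hc
  refine h fun n => ?_
  induction n with
  | zero => simp [monoEvent_zero]
  | succ n ih =>
    by_contra hn
    exact hc n ⟨ih, hn⟩

lemma antitone_monoEvent (S : ℕ → Ω → ℝ) : Antitone (monoEvent S 0) :=
  antitone_nat_of_succ_le fun n => by rw [monoEvent_succ]; exact inter_subset_left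

namespace MarkovMartingale

variable [MeasurableSpace Ω] (M : MarkovMartingale Ω)

instance : IsMarkovKernel M.K := M.markov

lemma measurable_S_filtration (n : ℕ) : Measurable[M.F n] (M.S n) :=
  ((M.mart 1 one_pos).1 n).measurable

lemma measurable_S (n : ℕ) : Measurable (M.S n) :=
  (M.measurable_S_filtration n).mono (M.F.le n) le_rfl

lemma measurableSet_filtration_monoEvent (n : ℕ) : MeasurableSet[M.F n] (monoEvent M.S 0 n) :=
  measurableSet_monoEvent fun j hj =>
    (M.measurable_S_filtration j).mono (M.F.mono hj) le_rfl

lemma measurableSet_monoEvent (n : ℕ) : MeasurableSet (monoEvent M.S 0 n) :=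
  M.F.le n _ (M.measurableSet_filtration_monoEvent n)

lemma kernel_ae_pos {x : ℝ} (hx : 0 < x) : ∀ᵐ y ∂M.K x, 0 < y := by
  rw [ae_iff]
  simpa [not_lt, Set.Iic] using M.kernel_pos x hx

lemma lintegral_kernel_ofReal {x : ℝ} (hx : 0 < x) :
    ∫⁻ y, ENNReal.ofReal y ∂M.K x = ENNReal.ofReal x := by
  have h := ofReal_integral_eq_lintegral_ofReal (M.kernel_int x hx)
    ((M.kernel_ae_pos hx).mono fun y hy => hy.le)
  simp only [id] at h
  rw [← h, M.kernel_mart x hx]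

lemma lvolOp_ofReal_le {x : ℝ} (hx : 0 < x) :
    lvolOp M.K ENNReal.ofReal x ≤ ENNReal.ofReal x :=
  (setLIntegral_le_lintegral _ _).trans (M.lintegral_kernel_ofReal hx).le

lemma lvolIter_succ_le (n : ℕ) : ∀ x, 0 < x → lvolIter M.K (n + 1) x ≤ lvolIter M.K n x := by
  induction n with
  | zero => exact fun x hx => M.lvolOp_ofReal_le hx
  | succ n ih =>
    intro x hx
    rw [lvolIter_succ M.K (n + 1), lvolIter_succ M.K n]
    refine lvolOp_mono M.K fun y hy => ?_
    rw [← lvolIter_succ]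
    exact ih y (hx.trans_le hy)

lemma antitone_lvolIter {x : ℝ} (hx : 0 < x) : Antitone fun n => lvolIter M.K n x :=
  antitone_nat_of_succ_le fun n => M.lvolIter_succ_le n x hx

lemma lvolIter_le {x : ℝ} (hx : 0 < x) (n : ℕ) : lvolIter M.K n x ≤ ENNReal.ofReal x :=
  M.antitone_lvolIter hx (Nat.zero_le n)

lemma lvolIter_ne_top {x : ℝ} (hx : 0 < x) (n : ℕ) : lvolIter M.K n x ≠ ∞ :=
  ne_top_of_le_ne_top ENNReal.ofReal_ne_top (M.lvolIter_le hx n)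

lemma lvolLim_le (x : ℝ) : lvolLim M.K x ≤ ENNReal.ofReal x :=
  iInf_le (fun n => lvolIter M.K n x) 0

lemma lvolLim_ne_top (x : ℝ) : lvolLim M.K x ≠ ∞ :=
  ne_top_of_le_ne_top ENNReal.ofReal_ne_top (M.lvolLim_le x)

lemma tendsto_lvolIter {x : ℝ} (hx : 0 < x) :
    Tendsto (fun n => lvolIter M.K n x) atTop (nhds (lvolLim M.K x)) :=
  tendsto_atTop_iInf (M.antitone_lvolIter hx)

/-- The limit `𝒦^∞(id)` is a fixed point of `𝒦`. -/
lemma lvolLim_eq {x : ℝ} (hx : 0 < x) : lvolLim M.K x = lvolOp M.K (lvolLim M.K) x := by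
  have h : lvolOp M.K (lvolLim M.K) x = ⨅ n, lvolIter M.K (n + 1) x := by
    simp only [lvolOp, lvolLim, lvolIter_succ]
    refine lintegral_iInf_ae (measurable_lvolIter M.K) (fun n => ?_) ?_
    · exact (ae_restrict_mem measurableSet_Ici).mono fun y hy =>
        M.lvolIter_succ_le n y (hx.trans_le hy)
    · exact ne_top_of_le_ne_top ENNReal.ofReal_ne_top (M.lvolOp_ofReal_le hx)
  rw [h]
  exact tendsto_nhds_unique ((M.tendsto_lvolIter hx).comp (tendsto_add_atTop_nat 1))
    (tendsto_atTop_iInf fun m n hmn => M.antitone_lvolIter hx (Nat.succ_le_succ hmn))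

lemma volOp_eq_toReal {f : ℝ → ℝ} {g : ℝ → ℝ≥0∞} (hg : Measurable g) {x : ℝ}
    (hfin : ∀ y, x ≤ y → g y ≠ ∞) (h : ∀ y, x ≤ y → f y = (g y).toReal) :
    volOp M.K f x = (lvolOp M.K g x).toReal := by
  rw [volOp, setIntegral_congr_fun measurableSet_Ici (fun y hy => h y hy),
    integral_toReal hg.aemeasurable]
  · rfl
  · exact (ae_restrict_mem measurableSet_Ici).mono fun y hy => (hfin y hy).lt_top

lemma volOp_iterate_eq (n : ℕ) : ∀ x, 0 < x →
    (volOp M.K)^[n] (fun y => y) x = (lvolIter M.K n x).toReal := by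
  induction n with
  | zero => exact fun x hx => (ENNReal.toReal_ofReal hx.le).symm
  | succ n ih =>
    intro x hx
    rw [Function.iterate_succ_apply', lvolIter_succ]
    exact M.volOp_eq_toReal (measurable_lvolIter M.K n)
      (fun y hy => M.lvolIter_ne_top (hx.trans_le hy) n) fun y hy => ih y (hx.trans_le hy)

/-- A solution of the Volterra equation in `I` is dominated by `𝒦^∞(id)`. -/
lemma le_lvolLim {N : ℝ → ℝ} (hN : InDom N) (hfix : ∀ x, 0 < x → N x = volOp M.K N x)
    {x : ℝ} (hx : 0 < x) : ENNReal.ofReal (N x) ≤ lvolLim M.K x := by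
  have hle : ∀ z, 0 < z → ENNReal.ofReal (N z) ≤ ENNReal.ofReal z := fun z hz =>
    ENNReal.ofReal_le_ofReal (hN.2 z hz).2
  have hlfix : ∀ z, x ≤ z → ENNReal.ofReal (N z) = lvolOp M.K (fun y => ENNReal.ofReal (N y)) z := by
    intro z hz
    have hz0 := hx.trans_le hz
    have hnn : ∀ᵐ y ∂(M.K z).restrict (Ici z), 0 ≤ N y ∧ N y ≤ y :=
      (ae_restrict_mem measurableSet_Ici).mono fun y hy => hN.2 y (hz0.trans_le hy)
    rw [hfix z hz0, volOp, lvolOp, ofReal_integral_eq_lintegral_ofReal _ (hnn.mono fun y h => h.1)]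
    refine (M.kernel_int z hz0).restrict.mono' hN.1.aestronglyMeasurable (hnn.mono fun y h => ?_)
    rw [Real.norm_of_nonneg h.1]
    exact h.2
  refine le_iInf fun n => ?_
  have := le_const_mul_iterate M.K ENNReal.measurable_ofReal (c := 1) hlfix
    (fun z hz => by rw [one_mul]; exact hle z (hx.trans_le hz)) n x le_rfl
  rwa [one_mul] at this

/-- The one-step Markov property, for the pair `(S_n, S_{n+1})` on an `F n`-measurable event. -/
lemma setLIntegral_step {x : ℝ} (hx : 0 < x) (n : ℕ) {A : Set Ω} (hA : MeasurableSet[M.F n] A)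
    {h : ℝ × ℝ → ℝ≥0∞} (hh : Measurable h) :
    ∫⁻ ω in A, h (M.S n ω, M.S (n + 1) ω) ∂M.P x =
      ∫⁻ ω in A, ∫⁻ y, h (M.S n ω, y) ∂M.K (M.S n ω) ∂M.P x := by
  have := M.prob x hx
  have hpair : ((M.P x).restrict A).map (fun ω => (M.S n ω, M.S (n + 1) ω)) =
      (((M.P x).restrict A).map (M.S n)).compProd M.K := by
    refine Measure.ext_prod fun {C B} hC hB => ?_
    have hCn : MeasurableSet[M.F n] (M.S n ⁻¹' C) := M.measurable_S_filtration n hC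
    have hg : Measurable (B.indicator (fun _ => (1 : ℝ))) := measurable_const.indicator hB
    have hgb : ∀ y, |B.indicator (fun _ => (1 : ℝ)) y| ≤ 1 := fun y => by
      by_cases hy : y ∈ B <;> simp [hy]
    have hint : Integrable (fun ω => B.indicator (fun _ => (1 : ℝ)) (M.S (n + 1) ω)) (M.P x) :=
      Integrable.of_bound (hg.comp (M.measurable_S (n + 1))).aestronglyMeasurable 1
        (Eventually.of_forall fun ω => hgb _)
    have hD : MeasurableSet[M.F n] (M.S n ⁻¹' C ∩ A) := hCn.inter hA
    have key := setIntegral_condExp (M.F.le n) hint hD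
    rw [setIntegral_congr_ae (M.F.le n _ hD)
      ((M.step x hx n _ hg ⟨1, hgb⟩).mono fun ω hω _ => hω)] at key
    have hleft : ∫ ω in M.S n ⁻¹' C ∩ A, B.indicator (fun _ => (1 : ℝ)) (M.S (n + 1) ω) ∂M.P x =
        (M.P x (M.S (n + 1) ⁻¹' B ∩ (M.S n ⁻¹' C ∩ A))).toReal := by
      have : (fun ω => B.indicator (fun _ => (1 : ℝ)) (M.S (n + 1) ω)) =
          (M.S (n + 1) ⁻¹' B).indicator 1 := rfl
      rw [this, integral_indicator_one (M.measurable_S (n + 1) hB), measureReal_def,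
        Measure.restrict_apply (M.measurable_S (n + 1) hB)]
    have hright : ∫ ω in M.S n ⁻¹' C ∩ A,
        ∫ y, B.indicator (fun _ => (1 : ℝ)) y ∂M.K (M.S n ω) ∂M.P x =
        (∫⁻ ω in M.S n ⁻¹' C ∩ A, M.K (M.S n ω) B ∂M.P x).toReal := by
      rw [← integral_toReal]
      · refine integral_congr_ae (Eventually.of_forall fun ω => ?_)
        exact integral_indicator_one hB
      · exact ((M.K.measurable_coe hB).comp (M.measurable_S n)).aemeasurable
      · exact Eventually.of_forall fun ω => measure_lt_top _ _
    rw [hleft, hright] at key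
    have hfin : ∫⁻ ω in M.S n ⁻¹' C ∩ A, M.K (M.S n ω) B ∂M.P x ≠ ∞ := by
      refine ne_top_of_le_ne_top (b := ∫⁻ _ in M.S n ⁻¹' C ∩ A, 1 ∂M.P x) ?_
        (lintegral_mono fun ω => prob_le_one)
      simp
    have key' := (ENNReal.toReal_eq_toReal_iff' hfin (measure_ne_top _ _)).mp key
    rw [Measure.compProd_apply_prod hC hB,
      setLIntegral_map hC (M.K.measurable_coe hB) (M.measurable_S n),
      Measure.restrict_restrict (M.measurable_S n hC), key',
      Measure.map_apply ((M.measurable_S n).prodMk (M.measurable_S (n + 1))) (hC.prod hB),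
      Measure.restrict_apply (((M.measurable_S n).prodMk (M.measurable_S (n + 1))) (hC.prod hB))]
    congr 1
    ext ω
    simp only [mem_inter_iff, mem_preimage, mem_prod]
    tauto
  have h2 : Measurable fun u => ∫⁻ y, h (u, y) ∂M.K u := hh.lintegral_kernel_prod_right'
  rw [← lintegral_map hh ((M.measurable_S n).prodMk (M.measurable_S (n + 1))), hpair,
    Measure.lintegral_compProd hh, lintegral_map h2 (M.measurable_S n)]

lemma setLIntegral_monoEvent_succ {x : ℝ} (hx : 0 < x) (n : ℕ) {f : ℝ → ℝ≥0∞}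
    (hf : Measurable f) :
    ∫⁻ ω in monoEvent M.S 0 (n + 1), f (M.S (n + 1) ω) ∂M.P x =
      ∫⁻ ω in monoEvent M.S 0 n, lvolOp M.K f (M.S n ω) ∂M.P x := by
  have hs : MeasurableSet {p : ℝ × ℝ | p.1 ≤ p.2} :=
    measurableSet_le measurable_fst measurable_snd
  have hms : MeasurableSet {ω | M.S n ω ≤ M.S (n + 1) ω} :=
    measurableSet_le (M.measurable_S n) (M.measurable_S (n + 1))
  have := M.setLIntegral_step hx n (M.measurableSet_filtration_monoEvent n)
    ((hf.comp measurable_snd).indicator hs)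
  rw [monoEvent_succ, inter_comm, ← Measure.restrict_restrict hms, ← lintegral_indicator hms]
  refine Eq.trans ?_ (this.trans ?_)
  · rfl
  · refine lintegral_congr fun ω => ?_
    rw [lvolOp, ← lintegral_indicator measurableSet_Ici]
    rfl

/-- `E_x[f(S_n); S_0 ≤ ⋯ ≤ S_n] = 𝒦ⁿ f (x)`. -/
lemma setLIntegral_monoEvent {x : ℝ} (hx : 0 < x) (n : ℕ) {f : ℝ → ℝ≥0∞} (hf : Measurable f) :
    ∫⁻ ω in monoEvent M.S 0 n, f (M.S n ω) ∂M.P x = (lvolOp M.K)^[n] f x := by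
  have := M.prob x hx
  induction n generalizing f with
  | zero =>
    rw [monoEvent_zero, Measure.restrict_univ,
      lintegral_congr_ae ((M.start x hx).mono fun ω hω => by rw [hω])]
    simp
  | succ n ih =>
    rw [M.setLIntegral_monoEvent_succ hx n hf, ih (measurable_lvolOp M.K hf),
      Function.iterate_succ_apply]

lemma lintegral_diff_add {x : ℝ} (hx : 0 < x) (n : ℕ) :
    ∫⁻ ω in monoEvent M.S 0 n \ monoEvent M.S 0 (n + 1), ENNReal.ofReal (M.S (n + 1) ω) ∂M.P x
      + lvolIter M.K (n + 1) x = lvolIter M.K n x := by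
  have hsub : monoEvent M.S 0 (n + 1) ⊆ monoEvent M.S 0 n := antitone_monoEvent M.S n.le_succ
  have hstep := M.setLIntegral_step hx n (M.measurableSet_filtration_monoEvent n)
    (ENNReal.measurable_ofReal.comp measurable_snd)
  have hsplit := lintegral_inter_add_sdiff (μ := M.P x)
    (fun ω => ENNReal.ofReal (M.S (n + 1) ω)) (monoEvent M.S 0 n) (M.measurableSet_monoEvent (n + 1))
  rw [inter_eq_right.mpr hsub, add_comm] at hsplit
  rw [lvolIter, lvolIter, ← M.setLIntegral_monoEvent hx _ ENNReal.measurable_ofReal,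
    ← M.setLIntegral_monoEvent hx _ ENNReal.measurable_ofReal, hsplit]
  refine hstep.trans (setLIntegral_congr_fun_ae (M.measurableSet_monoEvent n) ?_)
  exact (M.pos x hx).mono fun ω hω _ => M.lintegral_kernel_ofReal (hω n)

lemma sum_lintegral_diff_add {x : ℝ} (hx : 0 < x) (n : ℕ) :
    ∑ k ∈ Finset.range n, ∫⁻ ω in monoEvent M.S 0 k \ monoEvent M.S 0 (k + 1),
      ENNReal.ofReal (M.S (k + 1) ω) ∂M.P x + lvolIter M.K n x = ENNReal.ofReal x := by
  induction n with
  | zero => simp [lvolIter]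
  | succ n ih => rw [Finset.sum_range_succ, add_assoc, M.lintegral_diff_add hx n, ih]

lemma kernel_Ici_le {x c : ℝ} (hc : c ≤ M.a x) :
    M.K x (Ici x) ≤ 1 - ENNReal.ofReal c := by
  have hsum : M.K x (Ici x) + M.K x (Ico 0 x) ≤ 1 := by
    rw [← measure_union _ measurableSet_Ico]
    · exact prob_le_one
    · exact Set.disjoint_left.mpr fun y hy hy' => not_lt.mpr hy hy'.2
  have hca : ENNReal.ofReal c ≤ M.K x (Ico 0 x) :=
    ENNReal.ofReal_le_of_le_toReal hc
  exact ENNReal.le_sub_of_add_le_right ENNReal.ofReal_ne_top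
    ((add_le_add_right hca _).trans hsum)

/-- Monotone paths staying below `y` have geometrically decaying probability. -/
lemma iterate_indicator_le {x y c : ℝ} (hc : ∀ z ∈ Icc x y, c ≤ M.a z) (n : ℕ) :
    ∀ z, x ≤ z → (lvolOp M.K)^[n] ((Iic y).indicator 1) z ≤
      (Iic y).indicator (fun _ => (1 - ENNReal.ofReal c) ^ n) z := by
  induction n with
  | zero =>
    intro z _
    simp [Pi.one_def]
  | succ n ih =>
    intro z hz
    rw [Function.iterate_succ_apply']
    refine (lvolOp_mono M.K fun u hu => ih u (hz.trans hu)).trans ?_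
    by_cases hzy : z ≤ y
    · rw [indicator_of_mem (show z ∈ Iic y from hzy), pow_succ]
      calc lvolOp M.K ((Iic y).indicator fun _ => (1 - ENNReal.ofReal c) ^ n) z
          ≤ lvolOp M.K (fun _ => (1 - ENNReal.ofReal c) ^ n) z :=
            lvolOp_mono M.K fun u _ => indicator_le_self _ _ u
        _ = (1 - ENNReal.ofReal c) ^ n * M.K z (Ici z) := by simp [lvolOp]
        _ ≤ _ := by gcongr; exact M.kernel_Ici_le (hc z ⟨hz, hzy⟩)
    · rw [indicator_of_notMem (show z ∉ Iic y from hzy), lvolOp_congr M.K (g := fun _ => 0)]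
      · simp [lvolOp]
      · exact fun u hu => indicator_of_notMem (show u ∉ Iic y from fun huy => hzy (hu.trans huy)) _

lemma measure_iInter_monoEvent (ha : ∀ xa : ℝ, 0 < xa → M.ALowerBound xa) {x : ℝ} (hx : 0 < x) :
    M.P x (⋂ n, monoEvent M.S 0 n) = 0 := by
  have hbdd : ∀ k : ℕ,
      M.P x (⋂ n, monoEvent M.S 0 n ∩ M.S n ⁻¹' Iic (x + k + 1)) = 0 := by
    intro k
    obtain ⟨c, hc0, hc⟩ := (ha x hx).2 (x + k + 1) (by linarith [k.cast_nonneg (α := ℝ)])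
    have hn : ∀ n, M.P x (⋂ n, monoEvent M.S 0 n ∩ M.S n ⁻¹' Iic (x + k + 1)) ≤
        (1 - ENNReal.ofReal c) ^ n := by
      intro n
      have hm : MeasurableSet (M.S n ⁻¹' Iic (x + k + 1)) := M.measurable_S n measurableSet_Iic
      have hI : Measurable ((Iic (x + k + 1)).indicator (1 : ℝ → ℝ≥0∞)) :=
        measurable_one.indicator measurableSet_Iic
      calc _ ≤ M.P x (M.S n ⁻¹' Iic (x + k + 1) ∩ monoEvent M.S 0 n) :=
            measure_mono fun ω hω => (mem_iInter.mp hω n).symm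
        _ = ∫⁻ ω in monoEvent M.S 0 n, (Iic (x + k + 1)).indicator 1 (M.S n ω) ∂M.P x := by
            rw [← Measure.restrict_apply hm, ← lintegral_indicator_one hm]
            rfl
        _ = (lvolOp M.K)^[n] ((Iic (x + k + 1)).indicator 1) x :=
            M.setLIntegral_monoEvent hx n hI
        _ ≤ _ := (M.iterate_indicator_le hc n x le_rfl).trans (indicator_le_self _ _ x)
    have hlt : 1 - ENNReal.ofReal c < 1 :=
      ENNReal.sub_lt_self ENNReal.one_ne_top one_ne_zero (ENNReal.ofReal_pos.mpr hc0).ne'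
    exact le_antisymm
      (ge_of_tendsto' (ENNReal.tendsto_pow_atTop_nhds_zero_of_lt_one hlt) hn) (zero_le)
  have hsub : ∀ᵐ ω ∂M.P x, ω ∉ ⋂ n, monoEvent M.S 0 n := by
    have hall : ∀ᵐ ω ∂M.P x, ∀ k : ℕ,
        ω ∉ ⋂ n, monoEvent M.S 0 n ∩ M.S n ⁻¹' Iic (x + k + 1) :=
      ae_all_iff.mpr fun k => measure_eq_zero_iff_ae_notMem.mp (hbdd k)
    filter_upwards [hall, M.conv x hx] with ω hω hconv hmono
    obtain ⟨C, hC⟩ := hconv.bddAbove_range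
    obtain ⟨k, hk⟩ := exists_nat_ge C
    refine hω k (mem_iInter.mpr fun n => ⟨mem_iInter.mp hmono n, ?_⟩)
    have := hC (mem_range_self n)
    simp only [mem_preimage, mem_Iic]
    linarith
  exact measure_eq_zero_iff_ae_notMem.mpr hsub

/-- The probability of `n` successive non-downward moves tends to zero. -/
lemma tendsto_iterate_one (ha : ∀ xa : ℝ, 0 < xa → M.ALowerBound xa) {x : ℝ} (hx : 0 < x) :
    Tendsto (fun n => (lvolOp M.K)^[n] (fun _ => 1) x) atTop (nhds 0) := by
  have := M.prob x hx
  rw [← M.measure_iInter_monoEvent ha hx]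
  have h := tendsto_measure_iInter_atTop (μ := M.P x)
    (fun n => (M.measurableSet_monoEvent n).nullMeasurableSet) (antitone_monoEvent M.S)
    ⟨0, measure_ne_top _ _⟩
  refine h.congr fun n => ?_
  rw [← M.setLIntegral_monoEvent hx n measurable_const, setLIntegral_one]
  rfl

lemma defaultFn_eq (ha : ∀ xa : ℝ, 0 < xa → M.ALowerBound xa) {x : ℝ} (hx : 0 < x) :
    M.defaultFn x = (lvolLim M.K x).toReal := by
  set Z := evalAt M.S M.Sinf (drawdown M.S 1) with hZ
  set D : ℕ → Set Ω := fun n => monoEvent M.S 0 n \ monoEvent M.S 0 (n + 1) with hD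
  have hDm : ∀ n, MeasurableSet (D n) := fun n =>
    (M.measurableSet_monoEvent n).diff (M.measurableSet_monoEvent (n + 1))
  have hDd : Pairwise (Function.onFun Disjoint D) := by
    refine (pairwise_disjoint_on D).mpr fun m n hmn => ?_
    exact Set.disjoint_left.mpr fun ω h1 h2 => h1.2 (antitone_monoEvent M.S hmn h2.1)
  have hres : (M.P x).restrict (⋃ n, D n) = M.P x := by
    rw [iUnion_monoEvent_diff]
    refine Measure.restrict_eq_self_of_ae_mem ?_
    exact measure_eq_zero_iff_ae_notMem.mp (M.measure_iInter_monoEvent ha hx)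
  have hZm : AEMeasurable Z (M.P x) := by
    rw [← hres, aemeasurable_iUnion_iff]
    intro n
    refine (M.measurable_S (n + 1)).aemeasurable.congr ?_
    exact (ae_restrict_mem (hDm n)).mono fun ω hω => (evalAt_drawdown_one M.Sinf hω).symm
  have hZpos : 0 ≤ᵐ[M.P x] Z := by
    have h := M.pos x hx
    rw [← hres] at h ⊢
    filter_upwards [h, ae_restrict_mem (MeasurableSet.iUnion hDm)] with ω hω hmem
    obtain ⟨n, hn⟩ := mem_iUnion.mp hmem
    rw [hZ, Pi.zero_apply, evalAt_drawdown_one M.Sinf hn]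
    exact (hω _).le
  have hlint : ∫⁻ ω, ENNReal.ofReal (Z ω) ∂M.P x =
      ∑' n, ∫⁻ ω in D n, ENNReal.ofReal (M.S (n + 1) ω) ∂M.P x := by
    conv_lhs => rw [← hres]
    rw [lintegral_iUnion hDm hDd]
    refine tsum_congr fun n => setLIntegral_congr_fun (hDm n) fun ω hω => ?_
    exact congrArg ENNReal.ofReal (evalAt_drawdown_one M.Sinf hω)
  have hsum : ∫⁻ ω, ENNReal.ofReal (Z ω) ∂M.P x + lvolLim M.K x = ENNReal.ofReal x := by
    rw [hlint]
    refine tendsto_nhds_unique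
      ((ENNReal.tendsto_nat_tsum _).add (M.tendsto_lvolIter hx)) ?_
    exact tendsto_const_nhds.congr fun n => (M.sum_lintegral_diff_add hx n).symm
  have hfin : ∫⁻ ω, ENNReal.ofReal (Z ω) ∂M.P x ≠ ∞ :=
    ne_top_of_le_ne_top ENNReal.ofReal_ne_top (hsum ▸ le_self_add)
  have hreal := congrArg ENNReal.toReal hsum
  rw [ENNReal.toReal_add hfin (M.lvolLim_ne_top x), ENNReal.toReal_ofReal hx.le,
    ← integral_eq_lintegral_of_nonneg_ae hZpos hZm.aestronglyMeasurable] at hreal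
  rw [defaultFn]
  linarith

lemma ofReal_defaultFn (ha : ∀ xa : ℝ, 0 < xa → M.ALowerBound xa) {x : ℝ} (hx : 0 < x) :
    ENNReal.ofReal (M.defaultFn x) = lvolLim M.K x := by
  rw [M.defaultFn_eq ha hx, ENNReal.ofReal_toReal (M.lvolLim_ne_top x)]

lemma lvolLim_lt (ha : ∀ xa : ℝ, 0 < xa → M.ALowerBound xa) {x : ℝ} (hx : 0 < x) :
    lvolLim M.K x < ENNReal.ofReal x := by
  obtain ⟨c, hc0, hc⟩ := (ha x hx).2 (x + 1) (by linarith)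
  have hapos : 0 < M.a x := hc0.trans_le (hc x ⟨le_rfl, by linarith⟩)
  have hK : M.K x (Ico 0 x) ≠ 0 := fun h => by simp [a, h] at hapos
  have hdown : 0 < ∫⁻ y in Iio x, ENNReal.ofReal y ∂M.K x := by
    refine pos_iff_ne_zero.mpr fun h => hK ?_
    rw [lintegral_eq_zero_iff ENNReal.measurable_ofReal] at h
    have h' := (ae_restrict_iff' measurableSet_Iio).mp h
    refine measure_eq_zero_iff_ae_notMem.mpr ?_
    filter_upwards [h', M.kernel_ae_pos hx] with y hy hy0 hmem
    exact (ENNReal.ofReal_pos.mpr hy0).ne' (hy hmem.2)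
  have hsplit := lintegral_add_compl (μ := M.K x) ENNReal.ofReal (measurableSet_Ici (a := x))
  rw [compl_Ici, M.lintegral_kernel_ofReal hx] at hsplit
  have hup : lvolLim M.K x ≤ ∫⁻ y in Ici x, ENNReal.ofReal y ∂M.K x :=
    iInf_le (fun n => lvolIter M.K n x) 1
  rw [← hsplit]
  exact hup.trans_lt (ENNReal.lt_add_right
    (ne_top_of_le_ne_top ENNReal.ofReal_ne_top (M.lvolOp_ofReal_le hx)) hdown.ne')

/-- If `𝒦^∞(id)` vanishes above a level, it vanishes everywhere. -/
lemma lvolLim_eq_zero_of_eventually (ha : ∀ xa : ℝ, 0 < xa → M.ALowerBound xa) {x₀ : ℝ}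
    (h : ∀ x, x₀ ≤ x → lvolLim M.K x = 0) {x : ℝ} (hx : 0 < x) : lvolLim M.K x = 0 := by
  have hbound : ∀ y, x ≤ y → lvolLim M.K y ≤ ENNReal.ofReal x₀ * 1 := by
    intro y hy
    rcases le_total x₀ y with hy0 | hy0
    · rw [h y hy0]
      exact zero_le
    · rw [mul_one]
      exact (M.lvolLim_le y).trans (ENNReal.ofReal_le_ofReal hy0)
  have hle := fun n => le_const_mul_iterate M.K (g := fun _ => 1) measurable_const
    (fun y hy => M.lvolLim_eq (hx.trans_le hy)) hbound n x le_rfl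
  have hlim := ENNReal.Tendsto.const_mul (a := ENNReal.ofReal x₀)
    (M.tendsto_iterate_one ha hx) (Or.inr ENNReal.ofReal_ne_top)
  rw [mul_zero] at hlim
  exact le_antisymm (ge_of_tendsto' hlim hle) (zero_le)

/-- If `𝒦^∞(id) ≤ q • id` above a level for some `q < 1`, then `𝒦^∞(id)` vanishes there. -/
lemma lvolLim_eq_zero_of_le {q : ℝ≥0∞} (hq : q < 1) {x₀ : ℝ} (hx₀ : 0 < x₀)
    (h : ∀ x, x₀ ≤ x → lvolLim M.K x ≤ q * ENNReal.ofReal x) {x : ℝ} (hx : x₀ ≤ x) :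
    lvolLim M.K x = 0 := by
  have hx0 := hx₀.trans_le hx
  have hle := fun n => le_const_mul_iterate M.K ENNReal.measurable_ofReal
    (fun y hy => M.lvolLim_eq (hx₀.trans_le hy)) h n x hx
  have hlim := ENNReal.Tendsto.const_mul (a := q) (M.tendsto_lvolIter hx0)
    (Or.inr hq.ne_top)
  have hfix : lvolLim M.K x ≤ q * lvolLim M.K x := ge_of_tendsto' hlim hle
  by_contra hne
  have := ENNReal.mul_lt_mul_left hne (M.lvolLim_ne_top x) hq
  rw [one_mul] at this
  exact absurd hfix (not_le.mpr this)

lemma limsup_defaultFn_div (ha : ∀ xa : ℝ, 0 < xa → M.ALowerBound xa)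
    (hne : ∃ x : ℝ, 0 < x ∧ M.defaultFn x ≠ 0) :
    Filter.limsup (fun x => M.defaultFn x / x) atTop = 1 := by
  have hlow : ∀ᶠ x in atTop, 0 ≤ M.defaultFn x / x := by
    filter_upwards [eventually_gt_atTop 0] with x hx
    rw [M.defaultFn_eq ha hx]
    positivity
  have hup : ∀ᶠ x in atTop, M.defaultFn x / x ≤ 1 := by
    filter_upwards [eventually_gt_atTop 0] with x hx
    rw [M.defaultFn_eq ha hx, div_le_one hx]
    exact ENNReal.toReal_le_of_le_ofReal hx.le (M.lvolLim_le x)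
  refine le_antisymm (limsup_le_of_le (isCoboundedUnder_le_of_eventually_le _ hlow) hup) ?_
  by_contra! hlt
  obtain ⟨q, hq1, hq2⟩ := exists_between hlt
  have hev := eventually_lt_of_limsup_lt hq1 (isBoundedUnder_of_eventually_le hup)
  obtain ⟨x₀, hx₀⟩ := eventually_atTop.mp (hev.and (eventually_gt_atTop 0))
  have hpos : 0 < x₀ := (hx₀ x₀ le_rfl).2
  obtain ⟨x, hx, hx1⟩ := hne
  refine hx1 ?_
  have hzero : ∀ y, x₀ ≤ y → lvolLim M.K y = 0 := fun y hy =>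
    M.lvolLim_eq_zero_of_le (q := ENNReal.ofReal q) (by simpa using hq2) hpos (fun z hz => by
      obtain ⟨h1, h2⟩ := hx₀ z hz
      rw [← ENNReal.ofReal_mul' h2.le, ← M.ofReal_defaultFn ha h2]
      exact ENNReal.ofReal_le_ofReal ((div_lt_iff₀ h2).mp h1).le) hy
  rw [M.defaultFn_eq ha hx, M.lvolLim_eq_zero_of_eventually ha hzero hx, ENNReal.toReal_zero]

end MarkovMartingale

/-- Under the (any-level) lower bound assumption on `a`, the default function
`M_S` is the pointwise limit of the iterates `𝒦ⁿ(id)` and the maximal solution in `I` of the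
Volterra equation; moreover `M_S(x) < x` for all `x > 0` and, if `M_S` is non-trivial,
`limsup_{x→∞} M_S(x)/x = 1`. -/
theorem MarkovMartingale.defaultFn_maximal_solution
    {Ω : Type*} [MeasurableSpace Ω] (M : MarkovMartingale Ω)
    (ha : ∀ xa : ℝ, 0 < xa → M.ALowerBound xa) :
    (∀ x : ℝ, 0 < x →
      Tendsto (fun n => (volOp M.K)^[n] (fun y => y) x) atTop (nhds (M.defaultFn x))) ∧
    (∀ x : ℝ, 0 < x → M.defaultFn x = volOp M.K M.defaultFn x) ∧
    (∀ N, InDom N → (∀ x : ℝ, 0 < x → N x = volOp M.K N x) →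
      ∀ x : ℝ, 0 < x → N x ≤ M.defaultFn x) ∧
    (∀ x : ℝ, 0 < x → M.defaultFn x < x) ∧
    ((∃ x : ℝ, 0 < x ∧ M.defaultFn x ≠ 0) →
      Filter.limsup (fun x => M.defaultFn x / x) atTop = 1) := by
  refine ⟨fun x hx => ?_, fun x hx => ?_, fun N hN hfix x hx => ?_, fun x hx => ?_,
    M.limsup_defaultFn_div ha⟩
  · rw [M.defaultFn_eq ha hx]
    exact ((ENNReal.tendsto_toReal (M.lvolLim_ne_top x)).comp (M.tendsto_lvolIter hx)).congr
      fun n => (M.volOp_iterate_eq n x hx).symm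
  · rw [M.volOp_eq_toReal (measurable_lvolLim M.K)
      (fun y _ => M.lvolLim_ne_top y)
      (fun y hy => M.defaultFn_eq ha (hx.trans_le hy)),
      ← M.lvolLim_eq hx, M.defaultFn_eq ha hx]
  · rw [M.defaultFn_eq ha hx]
    exact (ENNReal.ofReal_le_iff_le_toReal (M.lvolLim_ne_top x)).mp (M.le_lvolLim hN hfix hx)
  · rw [M.defaultFn_eq ha hx]
    exact (ENNReal.lt_ofReal_iff_toReal_lt (M.lvolLim_ne_top x)).mp (M.lvolLim_lt ha hx)

end
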